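/- Let d be a positive natural number, r ∈ ℝ^d (with the Euclidean norm), and c > 0. Define r₊ ∈ ℝ^d by (r₊)_i = max(0, r_i), and let K = {θ ∈ ℝ^d : θ_i ≥ 0 for all i, and ‖θ‖ ≤ c}. Then the point θ* = (c / max(c, ‖r₊‖)) · r₊ lies in K and is the unique minimizer of ‖θ − r‖ over K; that is, ‖θ* − r‖ ≤ ‖θ − r‖ for all θ ∈ K, with equality only when θ = θ*. -/

import Mathlib

/-- A point `p` satisfying the variational inequality at `x` is at least as close to `r` as `x`,
with equality only if `x = p`. -/
theorem norm_sub_le_and_eq_of_inner_nonpos {E : Type*} [NormedAddCommGroup E]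
    [InnerProductSpace ℝ E] {p r x : E} (h : inner ℝ (r - p) (x - p) ≤ 0) :
    ‖p - r‖ ≤ ‖x - r‖ ∧ (‖p - r‖ = ‖x - r‖ → x = p) := by
  have key : ‖x - r‖ ^ 2 = ‖r - p‖ ^ 2 - 2 * inner ℝ (r - p) (x - p) + ‖x - p‖ ^ 2 := by
    rw [← norm_sub_sq_real, sub_sub_sub_cancel_right, norm_sub_rev]
  rw [norm_sub_rev p r]
  refine ⟨?_, fun he => ?_⟩
  · refine le_of_sq_le_sq ?_ (norm_nonneg _)
    nlinarith [sq_nonneg ‖x - p‖]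
  · rw [← he] at key
    have h0 : ‖x - p‖ ^ 2 = 0 := le_antisymm (by linarith) (sq_nonneg _)
    exact sub_eq_zero.mp (norm_eq_zero.mp (pow_eq_zero_iff two_ne_zero |>.mp h0))

theorem projection_nonneg_ball {d : ℕ} (hd : 0 < d)
    (r : EuclideanSpace ℝ (Fin d)) (c : ℝ) (hc : 0 < c)
    (rplus : EuclideanSpace ℝ (Fin d)) (hrplus : ∀ i, rplus i = max 0 (r i))
    (K : Set (EuclideanSpace ℝ (Fin d)))
    (hK : K = {θ : EuclideanSpace ℝ (Fin d) | (∀ i, 0 ≤ θ i) ∧ ‖θ‖ ≤ c})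
    (θstar : EuclideanSpace ℝ (Fin d))
    (hθstar : θstar = (c / max c ‖rplus‖) • rplus) :
    θstar ∈ K ∧ ∀ θ ∈ K, ‖θstar - r‖ ≤ ‖θ - r‖ ∧ (‖θstar - r‖ = ‖θ - r‖ → θ = θstar) := by
  subst hK
  have hm : 0 < max c ‖rplus‖ := lt_max_of_lt_left hc
  set t := c / max c ‖rplus‖ with ht
  have ht0 : 0 < t := div_pos hc hm
  have ht1 : t ≤ 1 := (div_le_one hm).mpr (le_max_left _ _)
  have htn : t * ‖rplus‖ ≤ c := by
    rw [ht, div_mul_eq_mul_div, div_le_iff₀ hm]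
    exact mul_le_mul_of_nonneg_left (le_max_right _ _) hc.le
  have hslack : (1 - t) * (c - t * ‖rplus‖) = 0 := by
    rcases le_total ‖rplus‖ c with h | h
    · rw [ht, max_eq_left h, div_self hc.ne', sub_self, zero_mul]
    · rw [max_eq_right h] at ht hm
      rw [ht, div_mul_cancel₀ _ hm.ne', sub_self, mul_zero]
  refine ⟨⟨fun i => ?_, ?_⟩, ?_⟩
  · rw [hθstar, PiLp.smul_apply, hrplus, smul_eq_mul]
    exact mul_nonneg ht0.le (le_max_left _ _)
  · rwa [hθstar, norm_smul, Real.norm_of_nonneg ht0.le]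
  rintro θ ⟨hθ, hθc⟩
  apply norm_sub_le_and_eq_of_inner_nonpos
  have h1 : inner ℝ r θ ≤ inner ℝ rplus θ := by
    simp only [PiLp.inner_apply, hrplus, RCLike.inner_apply, conj_trivial]
    exact Finset.sum_le_sum fun i _ => mul_le_mul_of_nonneg_left (le_max_right _ _) (hθ i)
  have h2 : inner ℝ r rplus = ‖rplus‖ ^ 2 := by
    rw [← real_inner_self_eq_norm_sq]
    simp only [PiLp.inner_apply, hrplus, RCLike.inner_apply, conj_trivial]
    refine Finset.sum_congr rfl fun i _ => ?_
    rcases le_total 0 (r i) with h | h <;> simp [h]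
  have h3 : inner ℝ rplus θ ≤ ‖rplus‖ * c :=
    (real_inner_le_norm _ _).trans (mul_le_mul_of_nonneg_left hθc (norm_nonneg _))
  have hexp : inner ℝ (r - θstar) (θ - θstar)
      = inner ℝ r θ - t * ‖rplus‖ ^ 2 - t * inner ℝ rplus θ + t ^ 2 * ‖rplus‖ ^ 2 := by
    rw [hθstar, inner_sub_left, inner_sub_right, inner_sub_right, real_inner_smul_left,
      real_inner_smul_left, real_inner_smul_right, real_inner_smul_right, h2,
      real_inner_self_eq_norm_sq]
    ring
  rw [hexp]
  calc _ ≤ (1 - t) * (‖rplus‖ * c) - t * (1 - t) * ‖rplus‖ ^ 2 := by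
        linarith [mul_le_mul_of_nonneg_left h3 (sub_nonneg.mpr ht1)]
    _ = ‖rplus‖ * ((1 - t) * (c - t * ‖rplus‖)) := by ring
    _ = 0 := by rw [hslack, mul_zero]
    _ ≤ 0 := le_rfl
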